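/- arXiv:math/0307248 — 5 statements merged into one kernel-verified Lean document; each statement's English description precedes it below -/
import Mathlib

section
/- For every x ∈ g_1 and every k ∈ ℤ/mℤ, one has dim g_k − dim z(x)_k = dim g_{−k−1} − dim z(x)_{−k−1}. -/
open LieAlgebra Module

variable (k : Type*) [Field k] [IsAlgClosed k] [CharZero k]
variable (g : Type*) [LieRing g] [LieAlgebra k g] [FiniteDimensional k g]
  [LieAlgebra.IsSemisimple k g]

/-- The `ζ^i`-eigenspace of the automorphism `θ`, i.e. the graded piece `g_i`. -/
noncomputable def gradePiece {m : ℕ} (ζ : k) (θ : g ≃ₗ[k] g) (i : ZMod m) : Submodule k g :=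
  Module.End.eigenspace (θ : g →ₗ[k] g) (ζ ^ i.val)

/-- The centraliser `z(x) = {y : ⁅x, y⁆ = 0}` of `x`. -/
noncomputable def zc (x : g) : Submodule k g := LinearMap.ker (LieAlgebra.ad k g x)

/-- Truncated exponential of an endomorphism; it agrees with the exponential series for
nilpotent endomorphisms of a finite-dimensional space. -/
noncomputable def expEnd (N : Module.End k g) : Module.End k g :=
  ∑ i ∈ Finset.range (Module.finrank k g + 1), ((i.factorial : k))⁻¹ • N ^ i

/-- The group `Int g` of inner automorphisms: the subgroup of the automorphism group
generated by `exp (ad n)` for `n` with `ad n` nilpotent. -/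
noncomputable def IntG : Subgroup (g ≃ₗ[k] g) :=
  Subgroup.closure {τ | ∃ n : g, IsNilpotent (LieAlgebra.ad k g n) ∧
    (τ : g →ₗ[k] g) = expEnd k g (LieAlgebra.ad k g n)}

/-- A Cartan subspace of `g_1`: a commutative subspace consisting of semisimple elements,
maximal among subspaces of `g_1` with these two properties. -/
def IsCartanSubspace (m : ℕ) (ζ : k) (θ : g ≃ₗ[k] g) (c : Submodule k g) : Prop :=
  c ≤ gradePiece k g ζ θ (1 : ZMod m) ∧
  (∀ x ∈ c, ∀ y ∈ c, ⁅x, y⁆ = 0) ∧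
  (∀ x ∈ c, (LieAlgebra.ad k g x).IsSemisimple) ∧
  ∀ c' : Submodule k g, c' ≤ gradePiece k g ζ θ (1 : ZMod m) →
    (∀ x ∈ c', ∀ y ∈ c', ⁅x, y⁆ = 0) → (∀ x ∈ c', (LieAlgebra.ad k g x).IsSemisimple) →
    c ≤ c' → c = c'

/-- Polynomial functions on `g`: functions arising from the symmetric algebra of `g*`. -/
def IsPolyFun (F : g → k) : Prop :=
  ∃ p : MvPolynomial (Module.Dual k g) k, ∀ x, F x = MvPolynomial.eval (fun φ => φ x) p

/-- The number `k_i = Σ_{c ∈ ℤ, c ≡ i (mod m)} dim {v ∈ z(e) : ⁅h, v⁆ = 2c • v}`. -/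
noncomputable def kNum (m : ℕ) (e h : g) (i : ZMod m) : ℕ :=
  ∑ᶠ c : ℤ, if ((c : ZMod m) = i) then
    Module.finrank k ↥(zc k g e ⊓ Module.End.eigenspace (LieAlgebra.ad k g h) (2 * (c : k)))
  else 0

/-- A bilinear pairing and its flip have the same rank. -/
theorem finrank_range_flip_aux {K V W : Type*} [Field K] [AddCommGroup V] [Module K V]
    [AddCommGroup W] [Module K W] [FiniteDimensional K V] [FiniteDimensional K W]
    (B : V →ₗ[K] W →ₗ[K] K) :
    Module.finrank K (LinearMap.range B.flip) = Module.finrank K (LinearMap.range B) := by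
  have h : B.flip = (LinearMap.dualMap B).comp
      (Module.evalEquiv K W : W →ₗ[K] Module.Dual K (Module.Dual K W)) := by
    ext w v
    simp
  rw [h, LinearMap.range_comp_of_range_eq_top _ (LinearEquiv.range _)]
  exact LinearMap.finrank_range_dualMap_eq_finrank_range B

theorem finrank_comap_aux {K V : Type*} [Field K] [AddCommGroup V] [Module K V]
    (Z U : Submodule K V) :
    Module.finrank K (Submodule.comap U.subtype Z) = Module.finrank K ↥(Z ⊓ U) := by
  have h : Submodule.comap U.subtype Z = Submodule.comap U.subtype (Z ⊓ U) := by
    ext v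
    simp
  rw [h]
  exact (Submodule.comapSubtypeEquivOfLe (inf_le_right : Z ⊓ U ≤ U)).finrank_eq

/-- The Killing form pairs opposite eigenspaces nondegenerately. -/
theorem killing_pair_aux {K L : Type*} [Field K] [CharZero K] [LieRing L] [LieAlgebra K L]
    [FiniteDimensional K L] [LieAlgebra.IsSemisimple K L]
    (m : ℕ) (hm : 1 ≤ m) (θ : L ≃ₗ[K] L) (hθb : ∀ x y : L, θ ⁅x, y⁆ = ⁅θ x, θ y⁆)
    (hθm : θ ^ m = 1) (a b : K) (hab : a * b = 1) (ham : a ^ m = 1)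
    (u : L) (hu : θ u = a • u)
    (h : ∀ w, θ w = b • w → killingForm K L u w = 0) : u = 0 := by
  have hinv : ∀ x y, killingForm K L (θ x) (θ y) = killingForm K L x y := by
    intro x y
    let e : L ≃ₗ⁅K⁆ L := { θ with map_lie' := fun {x y} => hθb x y }
    exact LieAlgebra.killingForm_of_equiv_apply e x y
  have key : ∀ (y : L) (j : ℕ),
      killingForm K L u (a ^ j • (θ ^ j) y) = killingForm K L u y := by
    intro y j
    induction j with
    | zero => simp
    | succ j ih =>
      rw [← ih, ← hinv u (a ^ j • (θ ^ j) y), hu, pow_succ' θ, LinearEquiv.mul_apply]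
      simp only [map_smul, LinearMap.smul_apply, smul_eq_mul]
      ring
  refine (LieAlgebra.IsKilling.killingForm_nondegenerate K L).1 u fun y => ?_
  have hp := h (∑ j ∈ Finset.range m, a ^ j • (θ ^ j) y) (by
    have e1 : a • θ (∑ j ∈ Finset.range m, a ^ j • (θ ^ j) y)
        = ∑ j ∈ Finset.range m, a ^ (j + 1) • (θ ^ (j + 1)) y := by
      rw [map_sum, Finset.smul_sum]
      refine Finset.sum_congr rfl fun j _ => ?_
      rw [map_smul, smul_smul, pow_succ' θ, LinearEquiv.mul_apply, pow_succ' a]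
    have e2 := (Finset.sum_range_succ (fun j => a ^ j • (θ ^ j) y) m).symm.trans
      (Finset.sum_range_succ' (fun j => a ^ j • (θ ^ j) y) m)
    rw [← e1] at e2
    simp only [ham, hθm, pow_zero] at e2
    have e3 := add_right_cancel e2
    conv_rhs => rw [e3]
    rw [smul_smul, mul_comm b a, hab, one_smul])
  rw [map_sum, Finset.sum_congr rfl fun j _ => key y j] at hp
  simp only [Finset.sum_const, Finset.card_range, nsmul_eq_mul] at hp
  exact (mul_eq_zero.mp hp).resolve_left (by exact_mod_cast (by omega : m ≠ 0))

theorem dim_diff_symm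
    (m : ℕ) (hm : 1 ≤ m) (ζ : k) (hζ : IsPrimitiveRoot ζ m)
    (θ : g ≃ₗ[k] g) (hθb : ∀ x y : g, θ ⁅x, y⁆ = ⁅θ x, θ y⁆) (hθm : θ ^ m = 1)
    (x : g) (hx : x ∈ gradePiece k g ζ θ (1 : ZMod m)) (i : ZMod m) :
    (Module.finrank k (gradePiece k g ζ θ i) : ℤ)
        - Module.finrank k ↥(zc k g x ⊓ gradePiece k g ζ θ i)
      = (Module.finrank k (gradePiece k g ζ θ (-i - 1)) : ℤ)
        - Module.finrank k ↥(zc k g x ⊓ gradePiece k g ζ θ (-i - 1)) := by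
  have : NeZero m := ⟨by omega⟩
  set a : k := ζ ^ i.val with ha
  set b : k := ζ ^ (-i - 1 : ZMod m).val with hb
  set c : k := ζ ^ (1 : ZMod m).val with hc
  have hζm := hζ.pow_eq_one
  have habc : a * b * c = 1 := by
    rw [ha, hb, hc, ← pow_add, ← pow_add, hζ.pow_eq_one_iff_dvd,
      ← ZMod.natCast_eq_zero_iff]
    push_cast
    simp only [ZMod.natCast_val, ZMod.cast_id', id_eq]
    ring
  have ham : a ^ m = 1 := by rw [ha, ← pow_mul, mul_comm, pow_mul, hζm, one_pow]
  have hbm : b ^ m = 1 := by rw [hb, ← pow_mul, mul_comm, pow_mul, hζm, one_pow]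
  have hcm : c ^ m = 1 := by rw [hc, ← pow_mul, mul_comm, pow_mul, hζm, one_pow]
  have hx' : θ x = c • x := Module.End.mem_eigenspace_iff.mp hx
  have hV : ∀ v, v ∈ gradePiece k g ζ θ i ↔ θ v = a • v := fun v =>
    Module.End.mem_eigenspace_iff
  have hW : ∀ v, v ∈ gradePiece k g ζ θ (-i - 1) ↔ θ v = b • v := fun v =>
    Module.End.mem_eigenspace_iff
  generalize gradePiece k g ζ θ i = V at *
  generalize gradePiece k g ζ θ (-i - 1) = W at *
  let B : V →ₗ[k] W →ₗ[k] k :=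
    LinearMap.domRestrict₁₂
      (LinearMap.comp (killingForm k g : g →ₗ[k] g →ₗ[k] k) (LieAlgebra.ad k g x : g →ₗ[k] g)) V W
  have hB : ∀ v w, B v w = killingForm k g ⁅x, (v : g)⁆ (w : g) := fun v w => rfl
  have hk1 : LinearMap.ker B = Submodule.comap V.subtype (zc k g x) := by
    ext v
    simp only [LinearMap.mem_ker, Submodule.mem_comap, zc, Submodule.subtype_apply,
      LieAlgebra.ad_apply]
    constructor
    · intro h
      refine killing_pair_aux m hm θ hθb hθm (c * a) b (by rw [← habc]; ring)
        (by rw [mul_pow, ham, hcm, one_mul]) _ ?_ ?_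
      · rw [hθb, hx', (hV _).mp v.2, smul_lie, lie_smul, smul_smul]
      · intro w hw
        have := LinearMap.congr_fun h ⟨w, (hW w).mpr hw⟩
        rwa [hB] at this
    · intro h
      ext w
      rw [hB, h]
      simp
  have hk2 : LinearMap.ker B.flip = Submodule.comap W.subtype (zc k g x) := by
    ext w
    simp only [LinearMap.mem_ker, Submodule.mem_comap, zc, Submodule.subtype_apply,
      LieAlgebra.ad_apply]
    have hB' : ∀ v, B v w = - killingForm k g ⁅x, (w : g)⁆ (v : g) := fun v => by
      rw [hB, LieModule.traceForm_apply_lie_apply', LieModule.traceForm_comm]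
    constructor
    · intro h
      refine killing_pair_aux m hm θ hθb hθm (c * b) a (by rw [← habc]; ring)
        (by rw [mul_pow, hbm, hcm, one_mul]) _ ?_ ?_
      · rw [hθb, hx', (hW _).mp w.2, smul_lie, lie_smul, smul_smul]
      · intro v hv
        have := LinearMap.congr_fun h ⟨v, (hV v).mpr hv⟩
        rw [LinearMap.flip_apply, hB'] at this
        simpa using this
    · intro h
      ext v
      rw [LinearMap.flip_apply, hB', h]
      simp
  have r1 := LinearMap.finrank_range_add_finrank_ker B
  have r2 := LinearMap.finrank_range_add_finrank_ker B.flip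
  rw [hk1, finrank_comap_aux] at r1
  rw [hk2, finrank_comap_aux, finrank_range_flip_aux] at r2
  omega
end

section
/- If x ∈ g_1 is semisimple, then dim z(x)_k = dim z(x)_{−k} for every k ∈ ℤ/mℤ. -/
open LieAlgebra Module

variable (k : Type*) [Field k] [IsAlgClosed k] [CharZero k]
variable (g : Type*) [LieRing g] [LieAlgebra k g] [FiniteDimensional k g]
  [LieAlgebra.IsSemisimple k g]

theorem exists_ker_add_range_aux {K V : Type*} [Field K] [AddCommGroup V] [Module K V]
    [FiniteDimensional K V] (f : Module.End K V) (hf : f.IsSemisimple) (v : V) :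
    ∃ a b : V, f a = 0 ∧ v = a + f b := by
  obtain ⟨q, hq, hc⟩ := Module.End.isSemisimple_iff.mp hf (LinearMap.ker f) (by
    intro z hz
    simp only [Submodule.mem_comap, LinearMap.mem_ker] at hz ⊢
    rw [hz, map_zero])
  have hmaps : ∀ z ∈ q, f z ∈ q := fun z hz => hq hz
  have hinj : Function.Injective (f.restrict hmaps) := by
    rw [← LinearMap.ker_eq_bot, LinearMap.ker_eq_bot']
    rintro ⟨z, hz⟩ h
    have h0 : f z = 0 := congrArg Subtype.val h
    have := (Submodule.disjoint_def.mp hc.disjoint) z h0 hz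
    exact Subtype.ext this
  have hsurj := LinearMap.injective_iff_surjective.mp hinj
  have hv : v ∈ LinearMap.ker f ⊔ q := by rw [hc.sup_eq_top]; trivial
  obtain ⟨a, ha, c, hcq, rfl⟩ := Submodule.mem_sup.mp hv
  obtain ⟨⟨b, hb⟩, hbc⟩ := hsurj ⟨c, hcq⟩
  have hbc' : f b = c := congrArg Subtype.val hbc
  exact ⟨a, b, ha, by rw [hbc']⟩

theorem dim_centralizer_piece_le_aux
    (m : ℕ) (hm : 1 ≤ m) (ζ : k) (hζ : IsPrimitiveRoot ζ m)
    (θ : g ≃ₗ[k] g) (hθb : ∀ x y : g, θ ⁅x, y⁆ = ⁅θ x, θ y⁆) (hθm : θ ^ m = 1)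
    (x : g) (hx : x ∈ gradePiece k g ζ θ (1 : ZMod m))
    (hss : (LieAlgebra.ad k g x).IsSemisimple) (i : ZMod m) :
    Module.finrank k ↥(zc k g x ⊓ gradePiece k g ζ θ i)
      ≤ Module.finrank k ↥(zc k g x ⊓ gradePiece k g ζ θ (-i)) := by
  have : NeZero m := ⟨by omega⟩
  have hζ0 : ζ ≠ 0 := hζ.ne_zero (by omega)
  have memG : ∀ (j : ZMod m) (y : g), y ∈ gradePiece k g ζ θ j ↔ θ y = ζ ^ j.val • y := by
    intro j y
    simp [gradePiece, Module.End.mem_eigenspace_iff]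
  have memZ : ∀ y : g, y ∈ zc k g x ↔ ⁅x, y⁆ = 0 := by
    intro y; simp [zc]
  rw [memG] at hx
  have hθker : ∀ w : g, ⁅x, w⁆ = 0 → ⁅x, θ w⁆ = 0 := by
    intro w hw
    have h := hθb x w
    rw [hw, map_zero, hx, smul_lie] at h
    exact (smul_eq_zero.mp h.symm).resolve_left (pow_ne_zero _ hζ0)
  let e : g ≃ₗ⁅k⁆ g := { θ with map_lie' := fun {a b} => hθb a b }
  have hκ : ∀ a b : g, killingForm k g (θ a) (θ b) = killingForm k g a b :=
    fun a b => LieAlgebra.killingForm_of_equiv_apply (R := k) e a b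
  set a : k := ζ ^ i.val with ha
  have ha0 : a ≠ 0 := pow_ne_zero _ hζ0
  have ham : a ^ m = 1 := by rw [ha, ← pow_mul, mul_comm, pow_mul, hζ.pow_eq_one, one_pow]
  have hneg : ζ ^ (-i).val = a⁻¹ := by
    apply eq_inv_of_mul_eq_one_right
    rw [ha, ← pow_add, hζ.pow_eq_one_iff_dvd, ← ZMod.natCast_eq_zero_iff]
    simp
  have key : ∀ y : g, ⁅x, y⁆ = 0 → θ y = a • y →
      (∀ w : g, ⁅x, w⁆ = 0 → θ w = a⁻¹ • w → killingForm k g y w = 0) → y = 0 := by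
    intro y hxy hy horth
    have hker : ∀ w : g, ⁅x, w⁆ = 0 → killingForm k g y w = 0 := by
      intro w hw
      let F : ℕ → g := fun j => a ^ j • (θ ^ j) w
      have hF : ∀ j, F (j + 1) = a • θ (F j) := by
        intro j
        simp only [F, map_smul, smul_smul, pow_succ', LinearEquiv.mul_apply]
      have hFx : ∀ j, ⁅x, F j⁆ = 0 := by
        intro j
        induction j with
        | zero => simpa [F] using hw
        | succ j ih => rw [hF, lie_smul, hθker _ ih, smul_zero]
      have hFκ : ∀ j, killingForm k g y (F j) = killingForm k g y w := by
        intro j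
        induction j with
        | zero => simp [F]
        | succ j ih =>
          rw [hF, ← ih, ← hκ y (F j), hy]
          simp
      have hS : a • θ (∑ j ∈ Finset.range m, F j) = ∑ j ∈ Finset.range m, F j := by
        rw [map_sum, Finset.smul_sum, ← Finset.sum_congr rfl (fun j _ => hF j)]
        have h1 := Finset.sum_range_succ F m
        rw [Finset.sum_range_succ'] at h1
        have h2 : F m = F 0 := by simp [F, ham, hθm]
        rw [h2] at h1
        exact add_right_cancel h1
      have h0 := horth (∑ j ∈ Finset.range m, F j)
        (by rw [lie_sum]; exact Finset.sum_eq_zero fun j _ => hFx j)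
        (by rw [eq_inv_smul_iff₀ ha0]; exact hS)
      rw [map_sum, Finset.sum_congr rfl (fun j _ => hFκ j)] at h0
      simp only [Finset.sum_const, Finset.card_range, nsmul_eq_mul, mul_eq_zero,
        Nat.cast_eq_zero] at h0
      exact h0.resolve_left (by omega)
    refine (LieAlgebra.IsKilling.killingForm_nondegenerate k g).1 y fun w => ?_
    obtain ⟨u, v, hu, rfl⟩ := exists_ker_add_range_aux (LieAlgebra.ad k g x) hss w
    rw [LieAlgebra.ad_apply] at hu ⊢
    rw [map_add, hker u hu, zero_add]
    have := LieModule.traceForm_apply_lie_apply' k g g x y v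
    rw [hxy] at this
    simpa using this.symm
  let B : ↥(zc k g x ⊓ gradePiece k g ζ θ i) →ₗ[k]
      Module.Dual k ↥(zc k g x ⊓ gradePiece k g ζ θ (-i)) :=
    (killingForm k g).domRestrict₁₂ _ _
  have hB : Function.Injective B := by
    rw [← LinearMap.ker_eq_bot, LinearMap.ker_eq_bot']
    rintro ⟨y, hy⟩ h
    rw [Submodule.mem_inf, memZ, memG] at hy
    apply Subtype.ext
    refine key y hy.1 hy.2 fun w hw hw' => ?_
    have hwm : w ∈ zc k g x ⊓ gradePiece k g ζ θ (-i) := by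
      rw [Submodule.mem_inf, memZ, memG, hneg]
      exact ⟨hw, hw'⟩
    exact LinearMap.congr_fun h ⟨w, hwm⟩
  have := LinearMap.finrank_le_finrank_of_injective hB
  rwa [Subspace.dual_finrank_eq] at this

theorem dim_centralizer_piece_symm
    (m : ℕ) (hm : 1 ≤ m) (ζ : k) (hζ : IsPrimitiveRoot ζ m)
    (θ : g ≃ₗ[k] g) (hθb : ∀ x y : g, θ ⁅x, y⁆ = ⁅θ x, θ y⁆) (hθm : θ ^ m = 1)
    (x : g) (hx : x ∈ gradePiece k g ζ θ (1 : ZMod m))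
    (hss : (LieAlgebra.ad k g x).IsSemisimple) (i : ZMod m) :
    Module.finrank k ↥(zc k g x ⊓ gradePiece k g ζ θ i)
      = Module.finrank k ↥(zc k g x ⊓ gradePiece k g ζ θ (-i)) := by
  have h1 := dim_centralizer_piece_le_aux k g m hm ζ hζ θ hθb hθm x hx hss i
  have h2 := dim_centralizer_piece_le_aux k g m hm ζ hζ θ hθb hθm x hx hss (-i)
  rw [neg_neg] at h2
  exact le_antisymm h1 h2
end

section
/- If x ∈ g_1 is semisimple, then the quantity dim g_k − dim z(x)_k does not depend on k ∈ ℤ/mℤ. -/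
open LieAlgebra Module

variable (k : Type*) [Field k] [IsAlgClosed k] [CharZero k]
variable (g : Type*) [LieRing g] [LieAlgebra k g] [FiniteDimensional k g]
  [LieAlgebra.IsSemisimple k g]

theorem aux_pow_add (k : Type*) [Field k] {m : ℕ} (hm : 1 ≤ m) (ζ : k) (h : ζ ^ m = 1)
    (i j : ZMod m) : ζ ^ (i + j).val = ζ ^ i.val * ζ ^ j.val := by
  have : NeZero m := ⟨by omega⟩
  rw [ZMod.val_add, ← pow_add, ← pow_eq_pow_mod _ h]

theorem aux_rank {k V : Type*} [Field k] [AddCommGroup V] [Module k V] [FiniteDimensional k V]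
    (f : V →ₗ[k] V) (p : Submodule k V) :
    Module.finrank k (p.map f) + Module.finrank k ↥(LinearMap.ker f ⊓ p) = Module.finrank k p := by
  have h := LinearMap.finrank_range_add_finrank_ker (f.domRestrict p)
  have h1 : LinearMap.range (f.domRestrict p) = p.map f := by
    rw [LinearMap.range_domRestrict]
  have h2 : (LinearMap.ker (f.domRestrict p)).map p.subtype = LinearMap.ker f ⊓ p := by
    ext y
    simp [and_comm]
  rw [← h1, ← h2, Submodule.finrank_map_subtype_eq]
  exact h

theorem dim_diff_independent
    (m : ℕ) (hm : 1 ≤ m) (ζ : k) (hζ : IsPrimitiveRoot ζ m)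
    (θ : g ≃ₗ[k] g) (hθb : ∀ x y : g, θ ⁅x, y⁆ = ⁅θ x, θ y⁆) (hθm : θ ^ m = 1)
    (x : g) (hx : x ∈ gradePiece k g ζ θ (1 : ZMod m))
    (hss : (LieAlgebra.ad k g x).IsSemisimple) (i j : ZMod m) :
    (Module.finrank k (gradePiece k g ζ θ i) : ℤ)
        - Module.finrank k ↥(zc k g x ⊓ gradePiece k g ζ θ i)
      = (Module.finrank k (gradePiece k g ζ θ j) : ℤ)
        - Module.finrank k ↥(zc k g x ⊓ gradePiece k g ζ θ j) := by
  set f : Module.End k g := LieAlgebra.ad k g x with hf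
  have hmem : ∀ (i : ZMod m) (y : g), y ∈ gradePiece k g ζ θ i → f y ∈ gradePiece k g ζ θ (i + 1) := by
    intro i y hy
    simp only [gradePiece, Module.End.mem_eigenspace_iff, LinearEquiv.coe_coe] at hx hy ⊢
    rw [hf, LieAlgebra.ad_apply, hθb, hx, hy, aux_pow_add k hm ζ hζ.pow_eq_one, smul_lie, lie_smul,
      smul_smul, mul_comm]
  have hinj : ∀ y, f (f y) = 0 → f y = 0 := by
    intro y hy
    have h1 := hss.isFinitelySemisimple.genEigenspace_eq_eigenspace (0 : k) (k := 2) (by norm_num)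
    have h2 : y ∈ f.genEigenspace 0 (2 : ℕ) := by
      rw [Module.End.mem_genEigenspace_nat]
      simp [pow_two, hy]
    have h3 : y ∈ f.eigenspace 0 := by
      rw [← h1]; exact h2
    simpa [Module.End.mem_eigenspace_iff] using h3
  have hstep : ∀ i : ZMod m, Module.finrank k ((gradePiece k g ζ θ i).map f) ≤
      Module.finrank k ((gradePiece k g ζ θ (i + 1)).map f) := by
    intro i
    have h := aux_rank f ((gradePiece k g ζ θ i).map f)
    have hb : LinearMap.ker f ⊓ (gradePiece k g ζ θ i).map f = ⊥ := by
      rw [eq_bot_iff]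
      rintro z ⟨hz, y, -, rfl⟩
      exact hinj y hz
    rw [hb, finrank_bot, add_zero] at h
    rw [← h]
    apply Submodule.finrank_mono
    apply Submodule.map_mono
    rintro z ⟨y, hy, rfl⟩
    exact hmem i y hy
  have hn : ∀ (n : ℕ) (i : ZMod m), Module.finrank k ((gradePiece k g ζ θ i).map f) ≤
      Module.finrank k ((gradePiece k g ζ θ (i + (n : ZMod m))).map f) := by
    intro n
    induction n with
    | zero => intro i; rw [Nat.cast_zero, add_zero]
    | succ n ih =>
      intro i
      have h := (ih i).trans (hstep (i + (n : ZMod m)))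
      rw [Nat.cast_succ, ← add_assoc]
      exact h
  have : NeZero m := ⟨by omega⟩
  have hle : ∀ i j : ZMod m, Module.finrank k ((gradePiece k g ζ θ i).map f) ≤
      Module.finrank k ((gradePiece k g ζ θ j).map f) := by
    intro i j
    have h := hn (j - i).val i
    rwa [ZMod.natCast_zmod_val, add_sub_cancel] at h
  have e := le_antisymm (hle i j) (hle j i)
  have hi := aux_rank f (gradePiece k g ζ θ i)
  have hj := aux_rank f (gradePiece k g ζ θ j)
  have hz : zc k g x = LinearMap.ker f := rfl
  rw [hz]
  omega
end

section
/- If x ∈ g_1 is semisimple, then dim [g_0, x] = (1/m) · dim [g, x], where [g_0, x] = {[y,x] : y ∈ g_0} and [g, x] = {[y,x] : y ∈ g} are the images of ad x restricted to g_0 and to g respectively. -/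
open LieAlgebra Module

variable (k : Type*) [Field k] [IsAlgClosed k] [CharZero k]
variable (g : Type*) [LieRing g] [LieAlgebra k g] [FiniteDimensional k g]
  [LieAlgebra.IsSemisimple k g]

theorem aux_finrank_iSup {K V : Type*} [Field K] [AddCommGroup V] [Module K V]
    [FiniteDimensional K V] {n : ℕ} (A : Fin n → Submodule K V) (h : iSupIndep A) :
    Module.finrank K ↥(⨆ i, A i) = ∑ i, Module.finrank K (A i) := by
  classical
  rw [Submodule.iSup_eq_range_dfinsupp_lsum, LinearMap.finrank_range_of_inj
    h.dfinsupp_lsum_injective]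
  exact Module.finrank_directSum (R := K) (fun i => A i)

theorem aux_main {K V : Type*} [Field K] [IsAlgClosed K] [CharZero K] [AddCommGroup V]
    [Module K V] [FiniteDimensional K V] (m : ℕ) (hm : 1 ≤ m) (ζ : K)
    (hζ : IsPrimitiveRoot ζ m) (θ T : Module.End K V) (hθm : θ ^ m = 1)
    (hT : ∀ y, θ (T y) = ζ • T (θ y)) (hss : T.IsSemisimple) :
    m * Module.finrank K (Submodule.map T (Module.End.eigenspace θ 1))
      = Module.finrank K (LinearMap.range T) := by
  have hker : ∀ y, T (T y) = 0 → T y = 0 := by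
    intro y hy
    have h := hss.isFinitelySemisimple.genEigenspace_eq_eigenspace (0 : K) (k := (2 : ℕ))
      (by norm_num)
    have hy2 : y ∈ T.genEigenspace 0 (2 : ℕ) := by
      rw [Module.End.mem_genEigenspace_nat]
      simp [pow_two, hy]
    rw [h, Module.End.mem_eigenspace_iff] at hy2
    simpa using hy2
  have hθss : θ.IsSemisimple := by
    refine Module.End.isSemisimple_of_squarefree_aeval_eq_zero
      (p := (Polynomial.X ^ m - 1 : Polynomial K)) ?_ ?_
    · refine (Polynomial.X_pow_sub_one_separable_iff.2 ?_).squarefree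
      exact_mod_cast (by omega : m ≠ 0)
    · simp [hθm]
  set W : ℕ → Submodule K V := fun n => Submodule.map T (Module.End.eigenspace θ (ζ ^ n)) with hW
  have hWE : ∀ n, W n ≤ Module.End.eigenspace θ (ζ ^ (n + 1)) := by
    rintro n _ ⟨y, hy, rfl⟩
    have hy' : θ y = ζ ^ n • y := Module.End.mem_eigenspace_iff.1 hy
    rw [Module.End.mem_eigenspace_iff, hT, hy', map_smul, smul_smul, pow_succ']
  have hle : ∀ n, Module.finrank K (W n) ≤ Module.finrank K (W (n + 1)) := by
    intro n
    have h1 : Submodule.map T (W n) ≤ W (n + 1) := Submodule.map_mono (hWE n)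
    refine le_trans (le_of_eq ?_) (Submodule.finrank_mono h1)
    have hinj : Function.Injective (T.domRestrict (W n)) := by
      rw [injective_iff_map_eq_zero]
      rintro ⟨_, ⟨y, hy, rfl⟩⟩ h
      exact Subtype.ext (hker y h)
    rw [← LinearMap.finrank_range_of_inj hinj, LinearMap.range_domRestrict]
  have hmono : Monotone fun n => Module.finrank K (W n) := monotone_nat_of_le_succ hle
  have hWm : W m = W 0 := by simp [hW, hζ.pow_eq_one]
  have hconst : ∀ n, n < m → Module.finrank K (W n) = Module.finrank K (W 0) := by
    intro n hn
    refine le_antisymm ?_ (hmono (Nat.zero_le n))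
    rw [← hWm]
    exact hmono hn.le
  have htop : (⨆ i : Fin m, Module.End.eigenspace θ (ζ ^ (i : ℕ))) = ⊤ := by
    rw [eq_top_iff, ← hθss.iSup_eigenspace_eq_top]
    refine iSup_le fun μ => ?_
    by_cases hμ : θ.HasEigenvalue μ
    · obtain ⟨v, hv⟩ := hμ.exists_hasEigenvector
      have hp := hv.pow_apply m
      rw [hθm] at hp
      have hp1 : μ ^ m = 1 := by
        have : (μ ^ m - 1) • v = 0 := by
          rw [sub_smul, ← hp]; simp
        rcases smul_eq_zero.1 this with h | h
        · exact sub_eq_zero.1 h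
        · exact absurd h hv.2
      haveI : NeZero m := ⟨by omega⟩
      obtain ⟨i, hi, rfl⟩ := hζ.eq_pow_of_pow_eq_one hp1
      exact le_iSup (fun i : Fin m => Module.End.eigenspace θ (ζ ^ (i : ℕ))) ⟨i, hi⟩
    · have : Module.End.eigenspace θ μ = ⊥ := by
        by_contra h
        exact hμ h
      rw [this]
      exact bot_le
  have hrange : LinearMap.range T = ⨆ i : Fin m, W i := by
    rw [LinearMap.range_eq_map, ← htop, Submodule.map_iSup]
  have hind : iSupIndep (fun i : Fin m => W i) := by
    have hζ0 : ζ ≠ 0 := hζ.ne_zero (by omega)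
    have hinj : Function.Injective (fun i : Fin m => ζ ^ ((i : ℕ) + 1)) := by
      intro i j hij
      have : ζ ^ (i : ℕ) = ζ ^ (j : ℕ) := by
        simpa [pow_succ, hζ0] using hij
      exact Fin.ext (hζ.pow_inj i.2 j.2 this)
    exact (θ.eigenspaces_iSupIndep.comp hinj).mono fun i => hWE i
  rw [hrange, aux_finrank_iSup _ hind, Finset.sum_congr rfl fun (i : Fin m) _ => hconst (i : ℕ) i.isLt]
  have hW0 : W 0 = Submodule.map T (Module.End.eigenspace θ 1) := by
    change Submodule.map T (Module.End.eigenspace θ (ζ ^ 0)) = _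
    rw [pow_zero]
  rw [hW0]
  simp

theorem dim_bracket_g0_eq
    (m : ℕ) (hm : 1 ≤ m) (ζ : k) (hζ : IsPrimitiveRoot ζ m)
    (θ : g ≃ₗ[k] g) (hθb : ∀ x y : g, θ ⁅x, y⁆ = ⁅θ x, θ y⁆) (hθm : θ ^ m = 1)
    (x : g) (hx : x ∈ gradePiece k g ζ θ (1 : ZMod m))
    (hss : (LieAlgebra.ad k g x).IsSemisimple) :
    m * Module.finrank k
        (Submodule.map (LieAlgebra.ad k g x) (gradePiece k g ζ θ (0 : ZMod m)))
      = Module.finrank k (LinearMap.range (LieAlgebra.ad k g x)) := by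
  have hζ1 : ζ ^ (1 : ZMod m).val = ζ := by
    rcases Nat.lt_or_ge 1 m with h | h
    · haveI : Fact (1 < m) := ⟨h⟩
      rw [ZMod.val_one, pow_one]
    · obtain rfl : m = 1 := le_antisymm h hm
      have : ζ = 1 := by simpa using hζ.pow_eq_one
      simp [this]
  have hx' : θ x = ζ • x := by
    have := Module.End.mem_eigenspace_iff.1 hx
    rw [hζ1] at this
    exact this
  have h0 : gradePiece k g ζ θ (0 : ZMod m) = Module.End.eigenspace (θ : g →ₗ[k] g) 1 := by
    simp [gradePiece]
  rw [h0]
  refine aux_main m hm ζ hζ (θ : g →ₗ[k] g) (LieAlgebra.ad k g x) ?_ ?_ hss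
  · have h := congrArg (fun e : g ≃ₗ[k] g => (e : g →ₗ[k] g)) hθm
    ext y
    have h2 := LinearMap.congr_fun h y
    have h3 : ∀ n : ℕ, ∀ y, ((θ : g →ₗ[k] g) ^ n : Module.End k g) y = (θ ^ n) y := by
      intro n
      induction n with
      | zero => intro y; rfl
      | succ n ih => intro y; rw [pow_succ, pow_succ]; exact ih (θ y)
    rw [h3]
    exact h2
  · intro y
    simp [hθb, hx']
end

section
/- If m = 2 (so θ is an involution), then dim [g_0, x] = (1/2) · dim [g, x] holds for every x ∈ g_1, where [g_0, x] = {[y,x] : y ∈ g_0} and [g, x] = {[y,x] : y ∈ g}. -/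
open LieAlgebra Module

variable (k : Type*) [Field k] [IsAlgClosed k] [CharZero k]
variable (g : Type*) [LieRing g] [LieAlgebra k g] [FiniteDimensional k g]
  [LieAlgebra.IsSemisimple k g]

theorem two_mul_finrank_map_of_skew {K V : Type*} [Field K] [AddCommGroup V] [Module K V]
    [FiniteDimensional K V] (B : LinearMap.BilinForm K V) (hB : B.Nondegenerate)
    (U W : Submodule K V) (hUW : IsCompl U W)
    (h1 : ∀ u ∈ U, ∀ w ∈ W, B u w = 0)
    (A : V →ₗ[K] V) (hA : ∀ y z, B (A y) z = - B y (A z))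
    (hAU : ∀ u ∈ U, A u ∈ W) (hAW : ∀ w ∈ W, A w ∈ U) :
    2 * finrank K (Submodule.map A U) = finrank K (LinearMap.range A) := by
  have hmU : Submodule.map A U ≤ W := by
    rintro _ ⟨u, hu, rfl⟩; exact hAU u hu
  have hmW : Submodule.map A W ≤ U := by
    rintro _ ⟨u, hu, rfl⟩; exact hAW u hu
  have e1 : finrank K (LinearMap.range A)
      = finrank K (Submodule.map A U) + finrank K (Submodule.map A W) := by
    have h := Submodule.finrank_sup_add_finrank_inf_eq (Submodule.map A U) (Submodule.map A W)
    have hd : Submodule.map A U ⊓ Submodule.map A W = ⊥ :=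
      ((hUW.disjoint.symm).mono hmU hmW).eq_bot
    rw [hd, finrank_bot, ← Submodule.map_sup, hUW.sup_eq_top, Submodule.map_top] at h
    simpa using h
  have e2 : finrank K (Submodule.map A W) + finrank K (W ⊓ LinearMap.ker A : Submodule K V)
      = finrank K W := by
    have h := LinearMap.finrank_range_add_finrank_ker (A.domRestrict W)
    have hr : LinearMap.range (A.domRestrict W) = Submodule.map A W := by
      ext v; simp
    have hk : Submodule.map W.subtype (LinearMap.ker (A.domRestrict W))
        = W ⊓ LinearMap.ker A := by
      rw [LinearMap.ker_domRestrict, Submodule.map_comap_subtype]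
    rw [hr] at h
    rw [← hk, Submodule.finrank_map_subtype_eq]
    exact h
  have e3 : finrank K U + finrank K W = finrank K V := Submodule.finrank_add_eq_of_isCompl hUW
  have e4 : finrank K (B.orthogonal (Submodule.map A U))
      = finrank K U + finrank K (W ⊓ LinearMap.ker A : Submodule K V) := by
    have ho : B.orthogonal (Submodule.map A U) = U ⊔ (W ⊓ LinearMap.ker A) := by
      apply le_antisymm
      · intro z hz
        have hz' : ∀ u ∈ U, B (A u) z = 0 := fun u hu =>
          LinearMap.BilinForm.mem_orthogonal_iff.mp hz (A u) ⟨u, hu, rfl⟩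
        obtain ⟨u, hu, w, hw, rfl⟩ :=
          Submodule.mem_sup.mp (hUW.sup_eq_top ▸ Submodule.mem_top : z ∈ U ⊔ W)
        refine Submodule.add_mem_sup hu ⟨hw, ?_⟩
        apply hB.2
        intro y
        obtain ⟨a, ha, b, hb, rfl⟩ :=
          Submodule.mem_sup.mp (hUW.sup_eq_top ▸ Submodule.mem_top : y ∈ U ⊔ W)
        have q1 : B a (A w) = 0 := by
          have q := hz' a ha
          rw [hA, map_add, map_add, h1 a ha _ (hAU u hu), zero_add, neg_eq_zero] at q
          exact q
        have q2 : B b (A w) = 0 := by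
          rw [← neg_eq_zero, ← hA, h1 _ (hAW b hb) w hw]
        rw [map_add, LinearMap.add_apply, q1, q2, add_zero]
      · refine sup_le ?_ ?_
        · intro u hu
          rw [LinearMap.BilinForm.mem_orthogonal_iff]
          rintro _ ⟨v, hv, rfl⟩
          rw [hA, h1 v hv _ (hAU u hu), neg_zero]
        · rintro w ⟨hw, hk⟩
          rw [LinearMap.BilinForm.mem_orthogonal_iff]
          rintro _ ⟨v, hv, rfl⟩
          rw [hA, LinearMap.mem_ker.mp hk, map_zero, neg_zero]
    have h := Submodule.finrank_sup_add_finrank_inf_eq U (W ⊓ LinearMap.ker A)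
    have hd : U ⊓ (W ⊓ LinearMap.ker A) = ⊥ :=
      (hUW.disjoint.mono_right inf_le_left).eq_bot
    rw [hd, finrank_bot, add_zero] at h
    rw [ho, h]
  have e5 := LinearMap.BilinForm.finrank_orthogonal hB (Submodule.map A U)
  have e6 := Submodule.finrank_le (Submodule.map A U)
  omega

theorem dim_bracket_g0_eq_involution
    (θ : g ≃ₗ[k] g) (hθb : ∀ x y : g, θ ⁅x, y⁆ = ⁅θ x, θ y⁆) (hθ2 : θ ^ 2 = 1)
    (x : g) (hx : x ∈ gradePiece k g (-1 : k) θ (1 : ZMod 2)) :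
    2 * Module.finrank k
        (Submodule.map (LieAlgebra.ad k g x) (gradePiece k g (-1 : k) θ (0 : ZMod 2)))
      = Module.finrank k (LinearMap.range (LieAlgebra.ad k g x)) := by
  have hm0 : ∀ v : g, v ∈ gradePiece k g (-1 : k) θ (0 : ZMod 2) ↔ θ v = v := by
    intro v
    simp [gradePiece, Module.End.mem_eigenspace_iff]
  have hm1 : ∀ v : g, v ∈ gradePiece k g (-1 : k) θ (1 : ZMod 2) ↔ θ v = -v := by
    intro v
    have : (1 : ZMod 2).val = 1 := rfl
    simp [gradePiece, Module.End.mem_eigenspace_iff, this]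
  have hinv : ∀ v, θ (θ v) = v := by
    intro v
    have := congrArg (fun f : g ≃ₗ[k] g => f v) hθ2
    simpa [pow_two] using this
  have h2 : (2 : k) ≠ 0 := two_ne_zero
  have hxx : θ x = -x := (hm1 x).mp hx
  let e : g ≃ₗ⁅k⁆ g := { θ with map_lie' := fun {a b} => hθb a b }
  have he : ∀ v, e v = θ v := fun _ => rfl
  have hK : ∀ a b, killingForm k g (θ a) (θ b) = killingForm k g a b := by
    intro a b
    rw [← he, ← he, LieAlgebra.killingForm_of_equiv_apply]
  refine two_mul_finrank_map_of_skew (killingForm k g)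
    (LieAlgebra.IsKilling.killingForm_nondegenerate k g) _
    (gradePiece k g (-1 : k) θ (1 : ZMod 2)) ?_ ?_ _ ?_ ?_ ?_
  · constructor
    · rw [Submodule.disjoint_def]
      intro v h0 h1
      rw [hm0] at h0
      rw [hm1, h0] at h1
      have : (2 : k) • v = 0 := by rw [two_smul]; nth_rewrite 1 [h1]; simp
      exact (smul_eq_zero.mp this).resolve_left h2
    · rw [codisjoint_iff, eq_top_iff]
      intro v _
      have hv : v = (2 : k)⁻¹ • (v + θ v) + (2 : k)⁻¹ • (v - θ v) := by
        rw [← smul_add, add_add_sub_cancel, ← two_smul k v, smul_smul, inv_mul_cancel₀ h2,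
          one_smul]
      rw [hv]
      refine Submodule.add_mem_sup ?_ ?_
      · rw [hm0, map_smul, map_add, hinv, add_comm]
      · rw [hm1, map_smul, map_sub, hinv, ← smul_neg, neg_sub]
  · intro u hu w hw
    have h := hK u w
    rw [(hm0 u).mp hu, (hm1 w).mp hw, map_neg] at h
    exact self_eq_neg.mp h.symm
  · intro y z
    exact LieModule.traceForm_apply_lie_apply' k g g x y z
  · intro u hu
    rw [hm1, LieAlgebra.ad_apply, hθb, (hm0 u).mp hu, hxx, neg_lie]
  · intro w hw
    rw [hm0, LieAlgebra.ad_apply, hθb, (hm1 w).mp hw, hxx, neg_lie, lie_neg, neg_neg]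
end
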